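/- arXiv:0911.3570 — 2 statements merged into one kernel-verified Lean document; each statement's English description precedes it below -/
import Mathlib

section
/- Every finite-dimensional power-commutative real division algebra A containing an omnipresent idempotent is a planar isotope of a quadratic division algebra: there exist a quadratic real division algebra structure B on the underlying vector space of A and a planar map T : B → B such that the multiplication of A equals the isotope multiplication x ∘ y = (Tx)·(Ty) of B_T. -/
open Module

section Defs

variable {A : Type*} [AddCommGroup A] [Module ℝ A]

/-- A linear subspace closed under the multiplication `m`. -/
def IsSubalg (m : A →ₗ[ℝ] A →ₗ[ℝ] A) (U : Submodule ℝ A) : Prop :=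
  ∀ x ∈ U, ∀ y ∈ U, m x y ∈ U

/-- The subalgebra generated by a set `s`: the smallest subspace containing `s`
and closed under multiplication. -/
def genSubalg (m : A →ₗ[ℝ] A →ₗ[ℝ] A) (s : Set A) : Submodule ℝ A :=
  sInf {U : Submodule ℝ A | IsSubalg m U ∧ s ⊆ (U : Set A)}

/-- `m` is a division-algebra multiplication: for nonzero `a`, both left and
right multiplication by `a` are bijective. -/
def IsDivision (m : A →ₗ[ℝ] A →ₗ[ℝ] A) : Prop :=
  ∀ a : A, a ≠ 0 →
    Function.Bijective (fun x : A => m a x) ∧ Function.Bijective (fun x : A => m x a)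

/-- Power-commutativity: every subalgebra generated by a single element is commutative. -/
def PowerComm (m : A →ₗ[ℝ] A →ₗ[ℝ] A) : Prop :=
  ∀ x : A, ∀ a ∈ genSubalg m {x}, ∀ b ∈ genSubalg m {x}, m a b = m b a

/-- An omnipresent idempotent: a nonzero idempotent contained in every
two-dimensional subalgebra. -/
def Omnipresent (m : A →ₗ[ℝ] A →ₗ[ℝ] A) (e : A) : Prop :=
  e ≠ 0 ∧ m e e = e ∧
    ∀ U : Submodule ℝ A, IsSubalg m U → Module.finrank ℝ U = 2 → e ∈ U

/-- `one` is an identity element for `m` and for every `x` the elements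
`one, x, x²` are linearly dependent. -/
def IsQuadraticWith (m : A →ₗ[ℝ] A →ₗ[ℝ] A) (one : A) : Prop :=
  (∀ x : A, m one x = x ∧ m x one = x) ∧
    ∀ x : A, ¬ LinearIndependent ℝ ![one, x, m x x]

/-- A quadratic algebra: unital, and `1, x, x²` linearly dependent for all `x`. -/
def IsQuadratic (m : A →ₗ[ℝ] A →ₗ[ℝ] A) : Prop :=
  ∃ one : A, IsQuadraticWith m one

/-- The isotope multiplication `x ∘ y = (T x)·(T y)`. -/
def isotope (m : A →ₗ[ℝ] A →ₗ[ℝ] A) (T : A →ₗ[ℝ] A) : A →ₗ[ℝ] A →ₗ[ℝ] A :=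
  (m.compl₂ T).comp T

/-- A planar map on a quadratic division algebra with identity `one`:
invertible, fixes `one`, and leaves every subalgebra invariant. -/
def Planar (m : A →ₗ[ℝ] A →ₗ[ℝ] A) (one : A) (T : A →ₗ[ℝ] A) : Prop :=
  Function.Bijective T ∧ T one = one ∧
    ∀ U : Submodule ℝ A, IsSubalg m U → ∀ x ∈ U, T x ∈ U

/-- The imaginary space `Im B = {x ∉ ℝ·1 : x² ∈ ℝ·1} ∪ {0}` of a quadratic algebra. -/
def ImSet (m : A →ₗ[ℝ] A →ₗ[ℝ] A) (one : A) : Set A :=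
  {x : A | x ∉ Submodule.span ℝ {one} ∧ m x x ∈ Submodule.span ℝ {one}} ∪ {0}

/-- The centraliser `C(e) = {y : e·y = y·e}`, a linear subspace. -/
def centraliser (m : A →ₗ[ℝ] A →ₗ[ℝ] A) (e : A) : Submodule ℝ A :=
  LinearMap.ker (m e - m.flip e)

/-- An exceptional idempotent of a four-dimensional algebra: its centraliser is
three-dimensional and closed under squaring. -/
def Exceptional (m : A →ₗ[ℝ] A →ₗ[ℝ] A) (e : A) : Prop :=
  Module.finrank ℝ (centraliser m e) = 3 ∧
    ∀ x ∈ centraliser m e, m x x ∈ centraliser m e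

end Defs

/-- A squaring map without nontrivial zeros on a finite-dimensional space is a closed map. -/
theorem isClosedMap_sq_of_forall_ne_zero {E : Type*} [NormedAddCommGroup E] [NormedSpace ℝ E]
    [FiniteDimensional ℝ E] (B : E →L[ℝ] E →L[ℝ] E) (h0 : ∀ x, B x x = 0 → x = 0) :
    IsClosedMap fun x => B x x := by
  have hcont : Continuous fun x => B x x := by fun_prop
  have : ProperSpace E := FiniteDimensional.proper_real E
  obtain ⟨c, hc, hcq⟩ : ∃ c > 0, ∀ x : E, c * ‖x‖ ^ 2 ≤ ‖B x x‖ := by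
    rcases subsingleton_or_nontrivial E with hE | hE
    · exact ⟨1, one_pos, fun x => by simp [Subsingleton.elim x 0]⟩
    obtain ⟨u, hu, hmin⟩ := (isCompact_sphere (0 : E) 1).exists_isMinOn
      (NormedSpace.sphere_nonempty.mpr zero_le_one) hcont.norm.continuousOn
    have hu1 : ‖u‖ = 1 := by simpa using hu
    have hu0 : u ≠ 0 := by rintro rfl; simp at hu1
    refine ⟨‖B u u‖, norm_pos_iff.mpr fun h => hu0 (h0 u h), fun x => ?_⟩
    rcases eq_or_ne x 0 with rfl | hx
    · simp
    have hxn : ‖x‖ ≠ 0 := norm_ne_zero_iff.mpr hx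
    have hle : ‖B u u‖ ≤ ‖B (‖x‖⁻¹ • x) (‖x‖⁻¹ • x)‖ :=
      hmin (by simp [norm_smul, hxn])
    have hscale : ‖B (‖x‖⁻¹ • x) (‖x‖⁻¹ • x)‖ * ‖x‖ ^ 2 = ‖B x x‖ := by
      simp [norm_smul]
      field_simp
    rw [← hscale]
    gcongr
  refine (isProperMap_iff_tendsto_cocompact.mpr ⟨hcont, ?_⟩).isClosedMap
  rw [← Metric.cobounded_eq_cocompact, ← tendsto_norm_atTop_iff_cobounded]
  refine Filter.tendsto_atTop_mono hcq (Filter.Tendsto.const_mul_atTop hc ?_)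
  exact (Filter.tendsto_pow_atTop two_ne_zero).comp tendsto_norm_cobounded_atTop

/-- The squaring map of a finite-dimensional commutative real algebra without zero divisors
is a covering map away from zero. -/
theorem isCoveringMapOn_sq {E : Type*} [NormedAddCommGroup E] [NormedSpace ℝ E]
    [FiniteDimensional ℝ E] (B : E →L[ℝ] E →L[ℝ] E) (hcomm : ∀ x y, B x y = B y x)
    (hdiv : ∀ x y, B x y = 0 → x = 0 ∨ y = 0) :
    IsCoveringMapOn (fun x => B x x) {0}ᶜ := by
  refine (isClosedMap_sq_of_forall_ne_zero B fun x hx => by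
    simpa using hdiv x x hx).isCoveringMapOn_of_isLocalHomeomorphOn (fun z _ => ?_) ?_
  · rcases Set.eq_empty_or_nonempty ((fun x => B x x) ⁻¹' {z}) with he | ⟨w, hw⟩
    · simp [he]
    refine (Set.toFinite {w, -w}).subset fun x hx => ?_
    have hxw : B (x - w) (x + w) = 0 := by
      have : B x x = B w w := hx.trans hw.symm
      simp [this, hcomm w x, add_comm]
    rcases hdiv _ _ hxw with h | h
    · exact Or.inl (sub_eq_zero.mp h)
    · exact Or.inr (eq_neg_of_add_eq_zero_left h)
  · intro x hx
    have hx0 : x ≠ 0 := by rintro rfl; simp at hx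
    let L : E →ₗ[ℝ] E := (2 : ℝ) • (B x : E →ₗ[ℝ] E)
    have hL : Function.Injective L := by
      refine (injective_iff_map_eq_zero L).mpr fun y hy => ?_
      have : B x y = 0 := by simpa [L] using hy
      exact (hdiv x y this).resolve_left hx0
    let φ : E ≃L[ℝ] E := (LinearEquiv.ofInjectiveEndo L hL).toContinuousLinearEquiv
    have hd : HasStrictFDerivAt (fun x => B x x) (φ : E →L[ℝ] E) x := by
      convert! B.hasStrictFDerivAt.clm_apply (hasStrictFDerivAt_id x) using 1
      ext y
      simp [φ, L, hcomm y x, two_smul]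
    exact ⟨_, hd.mem_toOpenPartialHomeomorph_source, by simp⟩

/-- If `p, r, s` are vectors in a real space of dimension at least three such that
the loop `cos² t • p + 2 cos t sin t • r + sin² t • s` avoids zero, then this loop extends to
a continuous map from the plane avoiding zero. -/
theorem exists_extension_conic {E : Type*} [NormedAddCommGroup E] [NormedSpace ℝ E]
    [FiniteDimensional ℝ E] (hn : 3 ≤ finrank ℝ E) (p r s : E)
    (hne : ∀ t : ℝ, Real.cos t ^ 2 • p + (2 * Real.cos t * Real.sin t) • r +
      Real.sin t ^ 2 • s ≠ 0) :
    ∃ F : C(ℂ, E), (∀ z, F z ≠ 0) ∧ ∀ t : ℝ, F (Complex.exp ((2 * t : ℝ) * Complex.I)) =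
      Real.cos t ^ 2 • p + (2 * Real.cos t * Real.sin t) • r + Real.sin t ^ 2 • s := by
  let F (v : E) (z : ℂ) : E :=
    (1 - ‖z‖) • v + (((‖z‖ + z.re) / 2) • p + z.im • r + ((‖z‖ - z.re) / 2) • s)
  have hcont (v : E) : Continuous (F v) := by
    have := Complex.continuous_re
    have := Complex.continuous_im
    fun_prop
  have hcirc (v : E) (t : ℝ) : F v (Complex.exp ((2 * t : ℝ) * Complex.I)) =
      Real.cos t ^ 2 • p + (2 * Real.cos t * Real.sin t) • r + Real.sin t ^ 2 • s := by
    simp only [F, Complex.norm_exp_ofReal_mul_I, Complex.exp_ofReal_mul_I_re,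
      Complex.exp_ofReal_mul_I_im, Real.cos_two_mul, Real.sin_two_mul]
    have hs : Real.sin t ^ 2 = 1 - Real.cos t ^ 2 := by linarith [Real.sin_sq_add_cos_sq t]
    rw [hs]
    module
  suffices h : ∃ v, ∀ z, F v z ≠ 0 by
    obtain ⟨v, hv⟩ := h
    exact ⟨⟨F v, hcont v⟩, hv, hcirc v⟩
  by_cases hspan : Submodule.span ℝ (Set.range ![p, r, s]) = ⊤
  · have hli : LinearIndependent ℝ ![p, r, s] := by
      rw [linearIndependent_iff_card_le_finrank_span, Set.finrank, hspan]
      simpa using hn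
    refine ⟨(1 / 2 : ℝ) • (p + s), fun z hz => ?_⟩
    have hz' : ((1 + z.re) / 2) • p + z.im • r + ((1 - z.re) / 2) • s = 0 := by
      rw [← hz]
      simp only [F]
      module
    have := Fintype.linearIndependent_iff.mp hli ![(1 + z.re) / 2, z.im, (1 - z.re) / 2]
      (by simpa [Fin.sum_univ_three] using hz')
    have h0 := this 0
    have h2 := this 2
    simp at h0 h2
    linarith
  · obtain ⟨v, hv⟩ : ∃ v, v ∉ Submodule.span ℝ (Set.range ![p, r, s]) := by
      by_contra! h
      exact hspan (Submodule.eq_top_iff'.mpr h)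
    refine ⟨v, fun z hz => ?_⟩
    by_cases hz1 : ‖z‖ = 1
    · have hzarg : z = Complex.exp ((2 * (z.arg / 2) : ℝ) * Complex.I) := by
        conv_lhs => rw [← Complex.norm_mul_exp_arg_mul_I z, hz1]
        rw [mul_div_cancel₀ _ (two_ne_zero' ℝ)]
        simp
      rw [hzarg, hcirc] at hz
      exact hne _ hz
    · refine hv (((Submodule.span ℝ _).smul_mem_iff (sub_ne_zero.mpr (Ne.symm hz1))).mp ?_)
      rw [eq_neg_of_add_eq_zero_left hz]
      have hmem (i : Fin 3) :=
        Submodule.subset_span (R := ℝ) (Set.mem_range_self (f := ![p, r, s]) i)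
      exact Submodule.neg_mem _ (Submodule.add_mem _ (Submodule.add_mem _
        (Submodule.smul_mem _ _ (hmem 0)) (Submodule.smul_mem _ _ (hmem 1)))
        (Submodule.smul_mem _ _ (hmem 2)))

/-- Hopf's theorem, for algebras whose underlying space is normed. -/
theorem finrank_le_two_of_comm_of_normed {E : Type*} [NormedAddCommGroup E] [NormedSpace ℝ E]
    [FiniteDimensional ℝ E] (B : E →L[ℝ] E →L[ℝ] E) (hcomm : ∀ x y, B x y = B y x)
    (hdiv : ∀ x y, B x y = 0 → x = 0 ∨ y = 0) : finrank ℝ E ≤ 2 := by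
  by_contra! hn
  have cov := isCoveringMapOn_sq B hcomm hdiv
  obtain ⟨x, hx⟩ := (finrank_pos_iff_exists_ne_zero (R := ℝ)).mp (by omega : 0 < finrank ℝ E)
  obtain ⟨y, hxy⟩ := exists_linearIndependent_pair_of_one_lt_finrank
    (by omega : 1 < finrank ℝ E) hx
  let h : C(ℝ, E) := ⟨fun t => Real.cos t • x + Real.sin t • y, by fun_prop⟩
  have hh (t : ℝ) : h t ≠ 0 := fun ht => by
    obtain ⟨hc, hs⟩ := LinearIndependent.pair_iff.mp hxy _ _ ht
    simpa [hc, hs] using Real.sin_sq_add_cos_sq t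
  have hsq (t : ℝ) : B (h t) (h t) = Real.cos t ^ 2 • B x x +
      (2 * Real.cos t * Real.sin t) • B x y + Real.sin t ^ 2 • B y y := by
    simp only [h, ContinuousMap.coe_mk, map_add, map_smul, add_apply,
      smul_apply, hcomm y x]
    module
  have hsq0 (t : ℝ) : B (h t) (h t) ≠ 0 := fun ht => hh t (by simpa using hdiv _ _ ht)
  obtain ⟨F, hF0, hF⟩ := exists_extension_conic hn (B x x) (B x y) (B y y)
    fun t => hsq t ▸ hsq0 t
  have hF1 : B x x = F 1 := by simpa using (hF 0).symm
  obtain ⟨G, ⟨hG1, hG⟩, -⟩ := cov.existsUnique_continuousMap_lifts F hF1 hF0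
  let g : C(ℝ, E) := G.comp ⟨fun t => Complex.exp ((2 * t : ℝ) * Complex.I), by fun_prop⟩
  have hgh : g = h := by
    refine (cov.existsUnique_continuousMap_lifts
      ⟨fun t => B (h t) (h t), by fun_prop⟩ (a₀ := 0) (e₀ := x) (by simp [h]) hsq0).unique
      ⟨by simp [g, hG1], funext fun t => ?_⟩ ⟨by simp [h], rfl⟩
    exact (congrFun hG _).trans ((hF t).trans (hsq t).symm)
  have hπ := DFunLike.congr_fun hgh Real.pi
  have hg : g Real.pi = x := by simp [g, hG1, Complex.exp_two_pi_mul_I]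
  have hhπ : h Real.pi = -x := by simp [h]
  rw [hg, hhπ] at hπ
  rw [eq_neg_iff_add_eq_zero, ← two_smul ℝ] at hπ
  exact hx (by simpa using hπ)

/-- Hopf's theorem: a subspace of finite dimension closed under a multiplication without zero
divisors, on which the multiplication is commutative, has dimension at most two. -/
theorem finrank_le_two_of_comm {A : Type*} [AddCommGroup A] [Module ℝ A] [FiniteDimensional ℝ A]
    (m : A →ₗ[ℝ] A →ₗ[ℝ] A) (hdiv : ∀ x y, m x y = 0 → x = 0 ∨ y = 0) (U : Submodule ℝ A)
    (hU : IsSubalg m U) (hcomm : ∀ x ∈ U, ∀ y ∈ U, m x y = m y x) : finrank ℝ U ≤ 2 := by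
  let φ := (finBasis ℝ U).equivFun
  let m' : (Fin (finrank ℝ U) → ℝ) →ₗ[ℝ] (Fin (finrank ℝ U) → ℝ) →ₗ[ℝ]
      (Fin (finrank ℝ U) → ℝ) :=
    LinearMap.mk₂ ℝ
      (fun x y => φ ⟨m (φ.symm x) (φ.symm y), hU _ (φ.symm x).2 _ (φ.symm y).2⟩)
      (fun _ _ _ => by rw [← map_add]; congr 1; ext; simp)
      (fun _ _ _ => by rw [← map_smul]; congr 1; ext; simp)
      (fun _ _ _ => by rw [← map_add]; congr 1; ext; simp)
      (fun _ _ _ => by rw [← map_smul]; congr 1; ext; simp)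
  have key := finrank_le_two_of_comm_of_normed
    (LinearMap.toContinuousLinearMap (LinearMap.toContinuousLinearMap.toLinearMap ∘ₗ m'))
    (fun x y => congrArg φ (Subtype.ext (hcomm _ (φ.symm x).2 _ (φ.symm y).2)))
    (fun x y hxy => by
      have hxy' := congrArg Subtype.val (φ.map_eq_zero_iff.mp hxy)
      simpa using hdiv _ _ hxy')
  simpa using key

theorem IsDivision.eq_zero_or_eq_zero {A : Type*} [AddCommGroup A] [Module ℝ A]
    {m : A →ₗ[ℝ] A →ₗ[ℝ] A} (hdiv : IsDivision m) {x y : A} (h : m x y = 0) :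
    x = 0 ∨ y = 0 := by
  refine or_iff_not_imp_left.mpr fun hx => (hdiv x hx).1.1 ?_
  simpa using h

theorem isSubalg_genSubalg {A : Type*} [AddCommGroup A] [Module ℝ A]
    (m : A →ₗ[ℝ] A →ₗ[ℝ] A) (s : Set A) : IsSubalg m (genSubalg m s) := by
  intro x hx y hy
  simp only [genSubalg, Submodule.mem_sInf] at hx hy ⊢
  exact fun U hU => hU.1 x (hx U hU) y (hy U hU)

theorem subset_genSubalg {A : Type*} [AddCommGroup A] [Module ℝ A]
    (m : A →ₗ[ℝ] A →ₗ[ℝ] A) (s : Set A) : s ⊆ (genSubalg m s : Set A) := by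
  intro x hx
  simp only [genSubalg, SetLike.mem_coe, Submodule.mem_sInf]
  exact fun U hU => hU.2 hx

theorem linearIndependent_pair_of_notMem_span_singleton {A : Type*} [AddCommGroup A]
    [Module ℝ A] {x y : A} (hx : x ≠ 0) (hy : y ∉ Submodule.span ℝ {x}) :
    LinearIndependent ℝ ![x, y] := by
  refine (LinearIndependent.pair_iff' hx).mpr fun a ha => hy ?_
  exact Submodule.mem_span_singleton.mpr ⟨a, ha⟩

/-- In a power-commutative division algebra with an omnipresent idempotent `e`, an element outside
`ℝ e` has a square proportional to itself, or spans together with `e` the subalgebra it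
generates. -/
theorem mul_self_eq_smul_or_genSubalg_eq_span {A : Type*} [AddCommGroup A] [Module ℝ A]
    [FiniteDimensional ℝ A] {m : A →ₗ[ℝ] A →ₗ[ℝ] A} (hdiv : IsDivision m) (hpc : PowerComm m)
    {e : A} (he : Omnipresent m e) {x : A} (hx : x ∉ Submodule.span ℝ {e}) :
    (∃ c : ℝ, m x x = c • x) ∨ genSubalg m {x} = Submodule.span ℝ {e, x} := by
  have hxU : x ∈ genSubalg m {x} := subset_genSubalg m {x} rfl
  have hx0 : x ≠ 0 := by rintro rfl; exact hx (zero_mem _)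
  have hle : finrank ℝ (genSubalg m {x}) ≤ 2 :=
    finrank_le_two_of_comm m (fun _ _ => hdiv.eq_zero_or_eq_zero) _ (isSubalg_genSubalg m _) (hpc x)
  rcases hle.lt_or_eq with h | h
  · left
    have hx1 : finrank ℝ (genSubalg m {x}) = 1 := by
      refine le_antisymm (by omega) ?_
      exact finrank_pos_iff_exists_ne_zero.mpr ⟨⟨x, hxU⟩, by simpa using hx0⟩
    obtain ⟨d, hd⟩ := (finrank_eq_one_iff_of_nonzero' (⟨x, hxU⟩ : genSubalg m {x})
      (by simpa using hx0)).mp hx1 ⟨m x x, isSubalg_genSubalg m _ x hxU x hxU⟩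
    exact ⟨d, (congrArg Subtype.val hd).symm⟩
  · right
    have heU := he.2.2 _ (isSubalg_genSubalg m _) h
    have hsub : Submodule.span ℝ {e, x} ≤ genSubalg m {x} := by
      rw [Submodule.span_le, Set.pair_subset_iff]
      exact ⟨heU, hxU⟩
    refine (Submodule.eq_of_le_of_finrank_le hsub ?_).symm
    have hli := linearIndependent_pair_of_notMem_span_singleton he.1 hx
    have := finrank_span_eq_card hli
    rw [Matrix.range_cons, Matrix.range_cons, Matrix.range_empty, Set.union_empty,
      Set.singleton_union] at this
    rw [this, h]
    simp

/-- In a power-commutative division algebra with an omnipresent idempotent `e`, every plane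
containing `e` is a subalgebra, and its elements commute with `e`. -/
theorem isSubalg_span_pair_of_notMem {A : Type*} [AddCommGroup A] [Module ℝ A]
    [FiniteDimensional ℝ A] {m : A →ₗ[ℝ] A →ₗ[ℝ] A} (hdiv : IsDivision m) (hpc : PowerComm m)
    {e : A} (he : Omnipresent m e) {x : A} (hx : x ∉ Submodule.span ℝ {e}) :
    IsSubalg m (Submodule.span ℝ {e, x}) ∧ m e x = m x e := by
  have hli := linearIndependent_pair_of_notMem_span_singleton he.1 hx
  have hpair := LinearIndependent.pair_iff.mp hli
  have good {a b : ℝ} (hb : b ≠ 0)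
      (hgen : genSubalg m {a • e + b • x} = Submodule.span ℝ {e, a • e + b • x}) :
      IsSubalg m (Submodule.span ℝ {e, x}) ∧ m e x = m x e := by
    have hspan : Submodule.span ℝ {e, a • e + b • x} = Submodule.span ℝ {e, x} := by
      refine le_antisymm ?_ ?_ <;> rw [Submodule.span_le, Set.pair_subset_iff]
      · exact ⟨Submodule.subset_span (by simp),
          Submodule.mem_span_pair.mpr ⟨a, b, rfl⟩⟩
      · refine ⟨Submodule.subset_span (by simp),
          Submodule.mem_span_pair.mpr ⟨-(b⁻¹ * a), b⁻¹, ?_⟩⟩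
        rw [smul_add, smul_smul, smul_smul, inv_mul_cancel₀ hb]
        module
    rw [hspan] at hgen
    rw [← hgen]
    exact ⟨isSubalg_genSubalg m _, hpc _ e (hgen ▸ Submodule.subset_span (by simp)) x
      (hgen ▸ Submodule.subset_span (by simp))⟩
  have hout {a b : ℝ} (hb : b ≠ 0) : a • e + b • x ∉ Submodule.span ℝ {e} := fun h => by
    obtain ⟨c, hc⟩ := Submodule.mem_span_singleton.mp h
    exact hb (neg_eq_zero.mp (hpair (c - a) (-b) (by
      rw [sub_smul, hc]; module)).2)
  by_contra hbad
  have hsq (a : ℝ) {b : ℝ} (hb : b ≠ 0) :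
      ∃ c : ℝ, m (a • e + b • x) (a • e + b • x) = c • (a • e + b • x) :=
    (mul_self_eq_smul_or_genSubalg_eq_span hdiv hpc he (hout hb)).resolve_right
      fun h => hbad (good hb h)
  obtain ⟨c, hc⟩ := hsq 0 one_ne_zero
  obtain ⟨c₁, h₁⟩ := hsq 1 one_ne_zero
  obtain ⟨c₂, h₂⟩ := hsq (-1) one_ne_zero
  have hxx : m x x = c • x := by simpa using hc
  simp only [map_add, map_smul, LinearMap.add_apply, LinearMap.smul_apply, he.2.1,
      hxx] at h₁ h₂
  obtain ⟨p, q⟩ := hpair (2 - c₁ + c₂) (2 * c - c₁ - c₂) (by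
    rw [← sub_eq_zero] at h₁ h₂
    rw [← add_zero (0 : A)]
    nth_rewrite 1 [← h₁]
    rw [← h₂]
    module)
  obtain rfl : c₁ = c + 1 := by linarith
  have hnil : m (-c • e + (1 : ℝ) • x) (-c • e + (1 : ℝ) • x) = 0 := by
    simp only [map_add, map_smul, LinearMap.add_apply, LinearMap.smul_apply, he.2.1,
      hxx]
    rw [← sub_eq_zero] at h₁
    rw [← smul_zero (-c), ← h₁]
    module
  refine hout (a := -c) one_ne_zero ?_
  rw [(or_self_iff.mp (hdiv.eq_zero_or_eq_zero hnil) : -c • e + (1 : ℝ) • x = 0)]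
  exact zero_mem _

/-- In a power-commutative division algebra with an omnipresent idempotent `e`, every element `x`
commutes with `e`, and the span of `e` and `x` is a subalgebra. -/
theorem isSubalg_span_pair {A : Type*} [AddCommGroup A] [Module ℝ A]
    [FiniteDimensional ℝ A] {m : A →ₗ[ℝ] A →ₗ[ℝ] A} (hdiv : IsDivision m) (hpc : PowerComm m)
    {e : A} (he : Omnipresent m e) (x : A) :
    IsSubalg m (Submodule.span ℝ {e, x}) ∧ m e x = m x e := by
  by_cases hx : x ∈ Submodule.span ℝ {e}
  · obtain ⟨c, rfl⟩ := Submodule.mem_span_singleton.mp hx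
    refine ⟨fun u hu v hv => ?_, by simp⟩
    obtain ⟨a, b, rfl⟩ := Submodule.mem_span_pair.mp hu
    obtain ⟨a', b', rfl⟩ := Submodule.mem_span_pair.mp hv
    refine Submodule.mem_span_pair.mpr ⟨(a + b * c) * (a' + b' * c), 0, ?_⟩
    simp only [map_add, map_smul, LinearMap.add_apply, LinearMap.smul_apply, he.2.1]
    module
  · exact isSubalg_span_pair_of_notMem hdiv hpc he hx

/-- Every finite-dimensional power-commutative real division algebra
containing an omnipresent idempotent is a planar isotope of a quadratic division
algebra on the same underlying vector space. -/
theorem stmt_13 {A : Type*} [AddCommGroup A] [Module ℝ A] [FiniteDimensional ℝ A]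
    (m : A →ₗ[ℝ] A →ₗ[ℝ] A) (hdiv : IsDivision m) (hpc : PowerComm m)
    (e : A) (he : Omnipresent m e) :
    ∃ (mB : A →ₗ[ℝ] A →ₗ[ℝ] A) (one : A) (T : A →ₗ[ℝ] A),
      IsDivision mB ∧ IsQuadraticWith mB one ∧ Planar mB one T ∧
      m = isotope mB T := by
  have hpair := isSubalg_span_pair hdiv hpc he
  let T : A ≃ₗ[ℝ] A := LinearEquiv.ofBijective (m e) (hdiv e he.1).1
  have hT (x : A) : T x = m e x := rfl
  have hTe : T e = e := he.2.1
  have hTe' : T.symm e = e := by rw [LinearEquiv.symm_apply_eq, hTe]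
  have hTmem (x : A) : T x ∈ Submodule.span ℝ {e, x} :=
    (hpair x).1 e (Submodule.subset_span (by simp)) x (Submodule.subset_span (by simp))
  have hTsymm (x : A) : T.symm x ∈ Submodule.span ℝ {e, x} := by
    have hmap : (Submodule.span ℝ {e, x}).map (T : A →ₗ[ℝ] A) = Submodule.span ℝ {e, x} := by
      refine Submodule.eq_of_le_of_finrank_le ?_ (LinearEquiv.finrank_map_eq T _).ge
      rw [Submodule.map_span_le]
      rintro y (hy | hy)
      · rw [hy, LinearEquiv.coe_coe, hTe]
        exact Submodule.subset_span (by simp)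
      · exact hy ▸ hTmem x
    have hx : x ∈ (Submodule.span ℝ {e, x}).map (T : A →ₗ[ℝ] A) := by
      rw [hmap]
      exact Submodule.subset_span (by simp)
    obtain ⟨y, hy, hyx⟩ := hx
    exact (T.symm_apply_eq.mpr hyx.symm : T.symm x = y) ▸ hy
  have hB (x y : A) : isotope m T.symm x y = m (T.symm x) (T.symm y) := rfl
  have hBdiv : IsDivision (isotope m T.symm) := fun a ha => by
    have := hdiv (T.symm a) (by simpa using ha)
    exact ⟨this.1.comp T.symm.bijective, this.2.comp T.symm.bijective⟩
  have hBone (x : A) : isotope m T.symm e x = x ∧ isotope m T.symm x e = x := by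
    rw [hB, hB, hTe', ← (hpair (T.symm x)).2, ← hT]
    simp
  have hBsq (x : A) : isotope m T.symm x x ∈ Submodule.span ℝ {e, x} :=
    (hpair x).1 _ (hTsymm x) _ (hTsymm x)
  refine ⟨isotope m T.symm, e, T, hBdiv, ⟨hBone, fun x hli => ?_⟩,
    ⟨T.bijective, hTe, fun U hU x hx => ?_⟩, ?_⟩
  · obtain ⟨a, b, hab⟩ := Submodule.mem_span_pair.mp (hBsq x)
    have := Fintype.linearIndependent_iff.mp hli ![a, b, -1]
      (by simp [Fin.sum_univ_three, hab]) 2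
    simp at this
  · by_cases hxe : x ∈ Submodule.span ℝ {e}
    · obtain ⟨c, rfl⟩ := Submodule.mem_span_singleton.mp hxe
      simpa [hTe] using hx
    have heU : e ∈ U := by
      obtain ⟨a, b, hab⟩ := Submodule.mem_span_pair.mp (hBsq x)
      have ha : a ≠ 0 := by
        rintro rfl
        have h0 : isotope m T.symm x (x - b • e) = 0 := by
          rw [map_sub, map_smul, (hBone x).2, ← hab]
          simp
        rcases hBdiv.eq_zero_or_eq_zero h0 with h | h
        · exact hxe (h ▸ zero_mem _)
        · exact hxe (Submodule.mem_span_singleton.mpr ⟨b, (sub_eq_zero.mp h).symm⟩)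
      refine (U.smul_mem_iff ha).mp ?_
      rw [← add_sub_cancel_right (a • e) (b • x), hab]
      exact U.sub_mem (hU x hx x hx) (U.smul_mem b hx)
    refine Submodule.span_le.mpr ?_ (hTmem x)
    rw [Set.pair_subset_iff]
    exact ⟨heU, hx⟩
  · ext x y
    simp [isotope]
end

section
/- Let A be a four-dimensional power-commutative real division algebra, B ⊆ A a two-dimensional subalgebra, and e ∈ A an idempotent that commutes with every element of B. Then e ∈ B. -/
open Module

section Aux

variable {A : Type*} [AddCommGroup A] [Module ℝ A] {m : A →ₗ[ℝ] A →ₗ[ℝ] A}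

theorem IsDivision.eq_zero_or_eq_zero_s16 (hdiv : IsDivision m) {a b : A} (h : m a b = 0) :
    a = 0 ∨ b = 0 := by
  by_cases ha : a = 0
  · exact Or.inl ha
  · exact Or.inr ((hdiv a ha).1.1 (by simpa using h))

theorem IsDivision.linearIndependent_mul (hdiv : IsDivision m) {a x y : A} (ha : a ≠ 0)
    (h : LinearIndependent ℝ ![x, y]) : LinearIndependent ℝ ![m a x, m a y] := by
  rw [LinearIndependent.pair_iff] at h ⊢
  intro s t hst
  refine h s t ((hdiv.eq_zero_or_eq_zero_s16 (a := a) ?_).resolve_left ha)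
  simpa using hst

/-- Two commuting elements with the same square agree up to sign. -/
theorem IsDivision.eq_or_eq_neg_of_sq_eq (hdiv : IsDivision m) {x y : A} (hxy : m x y = m y x)
    (h : m x x = m y y) : x = y ∨ x = -y := by
  have h0 : m (x - y) (x + y) = 0 := by
    simp only [map_sub, map_add, LinearMap.sub_apply, h, hxy]
    abel
  rcases hdiv.eq_zero_or_eq_zero_s16 h0 with h1 | h1
  · exact Or.inl (sub_eq_zero.mp h1)
  · exact Or.inr (eq_neg_of_add_eq_zero_left h1)

theorem exists_eq_smul_add_smul_of_finrank_eq_two {B : Submodule ℝ A}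
    (hB : Module.finrank ℝ B = 2) {x y : A} (hx : x ∈ B) (hy : y ∈ B)
    (h : LinearIndependent ℝ ![x, y]) {z : A} (hz : z ∈ B) :
    ∃ a b : ℝ, a • x + b • y = z := by
  have : FiniteDimensional ℝ B := Module.finite_of_finrank_pos (by omega)
  have hle : Submodule.span ℝ {x, y} ≤ B := by
    rw [Submodule.span_le]
    rintro w (rfl | rfl)
    exacts [hx, hy]
  have hfr : Module.finrank ℝ (Submodule.span ℝ {x, y}) = 2 := by
    rw [← Matrix.range_cons_cons_empty x y ![], finrank_span_eq_card h, Fintype.card_fin]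
  have heq := Submodule.eq_of_le_of_finrank_eq hle (hfr.trans hB.symm)
  rw [← heq] at hz
  exact Submodule.mem_span_pair.mp hz

theorem mem_genSubalg_singleton (x : A) : x ∈ genSubalg m {x} := by
  simp only [genSubalg, Submodule.mem_sInf]
  rintro U ⟨-, hU⟩
  exact hU rfl

theorem sq_mem_genSubalg_singleton (x : A) : m x x ∈ genSubalg m {x} := by
  simp only [genSubalg, Submodule.mem_sInf]
  rintro U ⟨h, hU⟩
  exact h x (hU rfl) x (hU rfl)

theorem exists_linearIndependent_of_finrank_eq_two {B : Submodule ℝ A}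
    (hB : Module.finrank ℝ B = 2) {x : A} (hx0 : x ≠ 0) :
    ∃ y ∈ B, LinearIndependent ℝ ![x, y] := by
  by_contra! hcon
  have hle : B ≤ Submodule.span ℝ {x} := by
    intro y hy
    have h := hcon y hy
    rw [LinearIndependent.pair_iff' hx0] at h
    push Not at h
    obtain ⟨a, rfl⟩ := h
    exact Submodule.smul_mem _ _ (Submodule.mem_span_singleton_self x)
  have h1 := Submodule.finrank_mono hle
  rw [finrank_span_singleton hx0] at h1
  omega

/-- Unless each of its elements is proportional to its own square, a two-dimensional subalgebra
has a generator. -/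
theorem PowerComm.mul_comm_of_linearIndependent (hpc : PowerComm m) {B : Submodule ℝ A}
    (hB : IsSubalg m B) (hBdim : Module.finrank ℝ B = 2) {x : A} (hx : x ∈ B)
    (h : LinearIndependent ℝ ![x, m x x]) :
    ∀ a ∈ B, ∀ b ∈ B, m a b = m b a := by
  have key : ∀ a ∈ B, a ∈ genSubalg m {x} := by
    intro a ha
    obtain ⟨s, t, rfl⟩ :=
      exists_eq_smul_add_smul_of_finrank_eq_two hBdim hx (hB x hx x hx) h ha
    exact add_mem (Submodule.smul_mem _ _ (mem_genSubalg_singleton x))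
      (Submodule.smul_mem _ _ (sq_mem_genSubalg_singleton x))
  exact fun a ha b hb => hpc x a (key a ha) b (key b hb)

theorem IsDivision.exists_linearIndependent_sq (hdiv : IsDivision m) {B : Submodule ℝ A}
    (hBdim : Module.finrank ℝ B = 2) : ∃ x ∈ B, LinearIndependent ℝ ![x, m x x] := by
  by_contra! hcon
  have hsq : ∀ x ∈ B, ∃ a : ℝ, m x x = a • x := by
    intro x hx
    by_cases hx0 : x = 0
    · exact ⟨0, by simp [hx0]⟩
    have h := hcon x hx
    rw [LinearIndependent.pair_iff' hx0] at h
    push Not at h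
    obtain ⟨a, ha⟩ := h
    exact ⟨a, ha.symm⟩
  have hB0 : B ≠ ⊥ := by
    rintro rfl
    simp at hBdim
  obtain ⟨x, hx, hx0⟩ := B.ne_bot_iff.mp hB0
  obtain ⟨y, hy, hxy⟩ := exists_linearIndependent_of_finrank_eq_two hBdim hx0
  rw [LinearIndependent.pair_iff] at hxy
  obtain ⟨a, ha⟩ := hsq x hx
  obtain ⟨b, hb⟩ := hsq y hy
  have hy0 : y ≠ 0 := by
    rintro rfl
    simpa using hxy 0 1 (by simp)
  have ha0 : a ≠ 0 := by
    rintro rfl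
    rw [zero_smul] at ha
    exact hx0 ((or_self_iff).mp (hdiv.eq_zero_or_eq_zero_s16 ha))
  have hb0 : b ≠ 0 := by
    rintro rfl
    rw [zero_smul] at hb
    exact hy0 ((or_self_iff).mp (hdiv.eq_zero_or_eq_zero_s16 hb))
  obtain ⟨c, hc⟩ := hsq (b • x - a • y) (sub_mem (B.smul_mem _ hx) (B.smul_mem _ hy))
  obtain ⟨d, hd⟩ := hsq (b • x + a • y) (add_mem (B.smul_mem _ hx) (B.smul_mem _ hy))
  have hsum : m (b • x - a • y) (b • x - a • y) + m (b • x + a • y) (b • x + a • y)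
      = (2 * b * b * a) • x + (2 * a * a * b) • y := by
    simp only [map_sub, map_add, map_smul, LinearMap.sub_apply, LinearMap.add_apply,
      LinearMap.smul_apply, ha, hb]
    module
  rw [hc, hd] at hsum
  obtain ⟨h1, h2⟩ := hxy ((c + d) * b - 2 * b * b * a) ((d - c) * a - 2 * a * a * b) (by
    rw [← sub_eq_zero] at hsum
    rw [← hsum]
    module)
  have h1' : c + d = 2 * a * b := mul_right_cancel₀ hb0 (by linarith)
  have h2' : d - c = 2 * a * b := mul_right_cancel₀ ha0 (by linarith)
  have hc0 : c = 0 := by linarith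
  rw [hc0, zero_smul] at hc
  have hz : b • x - a • y = 0 := (or_self_iff).mp (hdiv.eq_zero_or_eq_zero_s16 hc)
  exact hb0 (hxy b (-a) (by rw [← hz]; module)).1

theorem IsDivision.exists_sq_eq_neg_sq (hdiv : IsDivision m) {B : Submodule ℝ A}
    (hB : IsSubalg m B) (hBdim : Module.finrank ℝ B = 2)
    (hcomm : ∀ a ∈ B, ∀ b ∈ B, m a b = m b a) {u : A} (hu : u ∈ B) (hu0 : u ≠ 0) :
    ∃ v ∈ B, LinearIndependent ℝ ![u, v] ∧ m v v = -m u u := by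
  obtain ⟨w, hw, huw⟩ := exists_linearIndependent_of_finrank_eq_two hBdim hu0
  obtain ⟨p, q, hpq⟩ := exists_eq_smul_add_smul_of_finrank_eq_two hBdim (hB u hu u hu)
    (hB u hu w hw) (hdiv.linearIndependent_mul hu0 huw) (hB w hw w hw)
  set w' := w - (q / 2) • u with hw'
  have hw'B : w' ∈ B := sub_mem hw (B.smul_mem _ hu)
  have hne : ∀ t : ℝ, w' ≠ t • u := by
    intro t ht
    rw [LinearIndependent.pair_iff' hu0] at huw
    refine huw (t + q / 2) ?_
    rw [add_smul, ← ht, hw']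
    abel
  have hsq : m w' w' = (p + q ^ 2 / 4) • m u u := by
    simp only [hw', map_sub, map_smul, LinearMap.sub_apply, LinearMap.smul_apply,
      hcomm w hw u hu, ← hpq]
    module
  have hr : p + q ^ 2 / 4 < 0 := by
    by_contra! hr
    have hs : m w' w' = m (√(p + q ^ 2 / 4) • u) (√(p + q ^ 2 / 4) • u) := by
      rw [hsq, map_smul, map_smul, LinearMap.smul_apply, smul_smul, Real.mul_self_sqrt hr]
    rcases hdiv.eq_or_eq_neg_of_sq_eq (hcomm _ hw'B _ (B.smul_mem _ hu)) hs with h | h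
    · exact hne _ h
    · exact hne _ (h.trans (neg_smul _ _).symm)
  set r := -(p + q ^ 2 / 4) with hr_def
  have hr0 : 0 < √r := Real.sqrt_pos.mpr (by linarith)
  refine ⟨(√r)⁻¹ • w', B.smul_mem _ hw'B, ?_, ?_⟩
  · rw [LinearIndependent.pair_iff' hu0]
    intro t ht
    refine hne (√r * t) ?_
    rw [mul_smul, ht, smul_inv_smul₀ hr0.ne']
  · rw [map_smul, map_smul, LinearMap.smul_apply, hsq, smul_smul, smul_smul, ← mul_inv,
      Real.mul_self_sqrt (by linarith), ← neg_one_smul ℝ (m u u)]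
    congr 1
    have : r ≠ 0 := by linarith
    rw [show p + q ^ 2 / 4 = -r by rw [hr_def, neg_neg]]
    field_simp

/-- Every element of a two-dimensional commutative real division algebra is a square. -/
theorem IsDivision.exists_sq_eq (hdiv : IsDivision m) {B : Submodule ℝ A}
    (hB : IsSubalg m B) (hBdim : Module.finrank ℝ B = 2)
    (hcomm : ∀ a ∈ B, ∀ b ∈ B, m a b = m b a) {c : A} (hc : c ∈ B) :
    ∃ d ∈ B, m d d = c := by
  have hB0 : B ≠ ⊥ := by
    rintro rfl
    simp at hBdim
  obtain ⟨u, hu, hu0⟩ := B.ne_bot_iff.mp hB0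
  obtain ⟨v, hv, huv, hvv⟩ := hdiv.exists_sq_eq_neg_sq hB hBdim hcomm hu hu0
  obtain ⟨a, b, rfl⟩ := exists_eq_smul_add_smul_of_finrank_eq_two hBdim (hB u hu u hu)
    (hB u hu v hv) (hdiv.linearIndependent_mul hu0 huv) hc
  obtain ⟨z, hz⟩ := IsAlgClosed.exists_pow_nat_eq (⟨a, b⟩ : ℂ) two_pos
  have hre : z.re * z.re - z.im * z.im = a := by
    simpa [pow_two] using congrArg Complex.re hz
  have him : z.re * z.im + z.im * z.re = b := by
    simpa [pow_two] using congrArg Complex.im hz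
  refine ⟨z.re • u + z.im • v, add_mem (B.smul_mem _ hu) (B.smul_mem _ hv), ?_⟩
  simp only [map_add, map_smul, LinearMap.add_apply, LinearMap.smul_apply, hvv,
    hcomm v hv u hu, ← hre, ← him]
  module

end Aux

/-- In a four-dimensional power-commutative real division algebra, an
idempotent commuting with every element of a two-dimensional subalgebra `B` lies
in `B`. -/
theorem stmt_16 {A : Type*} [AddCommGroup A] [Module ℝ A] [FiniteDimensional ℝ A]
    (m : A →ₗ[ℝ] A →ₗ[ℝ] A)
    (hdim : Module.finrank ℝ A = 4)
    (hdiv : IsDivision m) (hpc : PowerComm m)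
    (B : Submodule ℝ A) (hB : IsSubalg m B) (hBdim : Module.finrank ℝ B = 2)
    (e : A) (he : m e e = e) (hcomm : ∀ y ∈ B, m e y = m y e) :
    e ∈ B := by
  by_contra heB
  obtain ⟨g, hg, hgg⟩ := hdiv.exists_linearIndependent_sq hBdim
  have hBcomm := hpc.mul_comm_of_linearIndependent hB hBdim hg hgg
  have hmem : ∀ b ∈ B, m e b ∈ B → b = 0 := by
    intro b hb heb
    by_contra hb0
    obtain ⟨y, hy, hby⟩ := exists_linearIndependent_of_finrank_eq_two hBdim hb0
    obtain ⟨s, t, hst⟩ := exists_eq_smul_add_smul_of_finrank_eq_two hBdim (hB b hb b hb)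
      (hB b hb y hy) (hdiv.linearIndependent_mul hb0 hby) heb
    have h : m b (s • b + t • y) = m b e := by
      rw [map_add, map_smul, map_smul, hst, hcomm b hb]
    have h' : s • b + t • y = e := (hdiv b hb0).1.1 h
    exact heB (h' ▸ add_mem (B.smul_mem s hb) (B.smul_mem t hy))
  let f : B →ₗ[ℝ] A ⧸ B := B.mkQ ∘ₗ m e ∘ₗ B.subtype
  have hf : Function.Injective f := by
    rw [← LinearMap.ker_eq_bot, LinearMap.ker_eq_bot']
    intro b hb
    exact Subtype.ext (hmem b b.2 ((Submodule.Quotient.mk_eq_zero B).mp hb))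
  have hfr : Module.finrank ℝ B = Module.finrank ℝ (A ⧸ B) := by
    have := B.finrank_quotient_add_finrank
    omega
  obtain ⟨b, hb⟩ := (LinearMap.injective_iff_surjective_of_finrank_eq_finrank hfr).mp hf
    (B.mkQ e)
  have hb' : m e b - e ∈ B := (Submodule.Quotient.eq B).mp hb
  have hx : m (e - (1 / 2 : ℝ) • (b : A)) (e - (1 / 2 : ℝ) • (b : A)) ∈ B := by
    have h : m (e - (1 / 2 : ℝ) • (b : A)) (e - (1 / 2 : ℝ) • (b : A))
        = (1 / 4 : ℝ) • m b b - (m e b - e) := by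
      simp only [map_sub, map_smul, LinearMap.sub_apply, LinearMap.smul_apply, he,
        ← hcomm b b.2]
      module
    rw [h]
    exact sub_mem (B.smul_mem _ (hB b b.2 b b.2)) hb'
  obtain ⟨d, hd, hdd⟩ := hdiv.exists_sq_eq hB hBdim hBcomm hx
  have hdc : m (e - (1 / 2 : ℝ) • (b : A)) d = m d (e - (1 / 2 : ℝ) • (b : A)) := by
    simp only [map_sub, map_smul, LinearMap.sub_apply, LinearMap.smul_apply, hcomm d hd,
      hBcomm b b.2 d hd]
  have hhalf : (1 / 2 : ℝ) • (b : A) ∈ B := B.smul_mem _ b.2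
  refine heB ((B.sub_mem_iff_left hhalf).mp ?_)
  rcases hdiv.eq_or_eq_neg_of_sq_eq hdc hdd.symm with h | h
  · exact h ▸ hd
  · exact h ▸ neg_mem hd
end
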